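/- arXiv:2008.05705 — 2 statements merged into one kernel-verified Lean document; each statement's English description precedes it below -/
import Mathlib

section
/- Let ℓ₁, ℓ₂, ℓ₃ be homogeneous linear polynomials ℓᵢ = AᵢX + BᵢY + CᵢZ in K[X,Y,Z] with (A₁,B₁,C₁) ≠ (0,0,0), and set F := ℓ₁ℓ₂ℓ₃. Let P' = (α', β', 1) satisfy E(P') = 0 and ℓ₁(P') = 0, where E = X³ + a₂X²Z + a₄XZ² + a₆Z³ − Y²Z − a₁XYZ − a₃YZ², and assume the gradient (∂_X E(P'), ∂_Y E(P'), ∂_Z E(P')) is nonzero. Then the following are equivalent: (i) there exists λ ∈ K with ∂_X F(P') = λ · ∂_X E(P') and ∂_Y F(P') = λ · ∂_Y E(P'); (ii) either (A₁,B₁,C₁) is a nonzero scalar multiple of (∂_X E(P'), ∂_Y E(P'), ∂_Z E(P')) (i.e., ℓ₁ is the tangent line of E at P'), or ℓ₂(P') = 0, or ℓ₃(P') = 0. -/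
open MvPolynomial

/-- The homogeneous Weierstrass cubic
`E = X³ + a₂X²Z + a₄XZ² + a₆Z³ − Y²Z − a₁XYZ − a₃YZ²` in `K[X,Y,Z]`,
where the variables `X`, `Y`, `Z` are indexed by `0`, `1`, `2 : Fin 3`. -/
noncomputable def weierstrassCubic {K : Type*} [CommRing K] (a₁ a₂ a₃ a₄ a₆ : K) :
    MvPolynomial (Fin 3) K :=
  X 0 ^ 3 + C a₂ * X 0 ^ 2 * X 2 + C a₄ * X 0 * X 2 ^ 2 + C a₆ * X 2 ^ 3
    - X 1 ^ 2 * X 2 - C a₁ * X 0 * X 1 * X 2 - C a₃ * X 1 * X 2 ^ 2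

/-- Euler's identity for the Weierstrass cubic at an affine point. -/
lemma weierstrassCubic_euler {K : Type*} [CommRing K] (a₁ a₂ a₃ a₄ a₆ α β : K) :
    α * eval ![α, β, 1] (pderiv 0 (weierstrassCubic a₁ a₂ a₃ a₄ a₆))
      + β * eval ![α, β, 1] (pderiv 1 (weierstrassCubic a₁ a₂ a₃ a₄ a₆))
      + eval ![α, β, 1] (pderiv 2 (weierstrassCubic a₁ a₂ a₃ a₄ a₆))
      = 3 * eval ![α, β, 1] (weierstrassCubic a₁ a₂ a₃ a₄ a₆) := by
  simp [weierstrassCubic, pderiv_X, Derivation.leibniz_pow]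
  ring

/-- At a zero of `p`, a derivation of `p * q * r` only sees the derivative of `p`. -/
lemma eval_pderiv_mul_mul_of_eval_eq_zero {K σ : Type*} [CommRing K] (x : σ → K) (i : σ)
    {p : MvPolynomial σ K} (q r : MvPolynomial σ K) (hp : eval x p = 0) :
    eval x (pderiv i (p * q * r)) = eval x (pderiv i p) * (eval x q * eval x r) := by
  simp only [pderiv_mul, map_add, map_mul, hp]
  ring

theorem multiple_intersection_point_iff {K : Type*} [Field K] (a₁ a₂ a₃ a₄ a₆ : K)
    (A₁ B₁ C₁ A₂ B₂ C₂ A₃ B₃ C₃ : K) (hl₁ : (A₁, B₁, C₁) ≠ (0, 0, 0)) (α' β' : K)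
    -- the three lines and their product `F`
    (ℓ₁ ℓ₂ ℓ₃ F : MvPolynomial (Fin 3) K)
    (hℓ₁ : ℓ₁ = C A₁ * X 0 + C B₁ * X 1 + C C₁ * X 2)
    (hℓ₂ : ℓ₂ = C A₂ * X 0 + C B₂ * X 1 + C C₂ * X 2)
    (hℓ₃ : ℓ₃ = C A₃ * X 0 + C B₃ * X 1 + C C₃ * X 2)
    (hF : F = ℓ₁ * ℓ₂ * ℓ₃)
    -- the point `P' = (α', β', 1)` lies on `E` and on `ℓ₁`
    (hE : eval ![α', β', 1] (weierstrassCubic a₁ a₂ a₃ a₄ a₆) = 0)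
    (hP : eval ![α', β', 1] ℓ₁ = 0)
    -- the gradient of `E` at `P'` is nonzero
    (hgrad : ¬(eval ![α', β', 1] (pderiv 0 (weierstrassCubic a₁ a₂ a₃ a₄ a₆)) = 0 ∧
               eval ![α', β', 1] (pderiv 1 (weierstrassCubic a₁ a₂ a₃ a₄ a₆)) = 0 ∧
               eval ![α', β', 1] (pderiv 2 (weierstrassCubic a₁ a₂ a₃ a₄ a₆)) = 0)) :
    (∃ l : K,
        eval ![α', β', 1] (pderiv 0 F)
          = l * eval ![α', β', 1] (pderiv 0 (weierstrassCubic a₁ a₂ a₃ a₄ a₆)) ∧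
        eval ![α', β', 1] (pderiv 1 F)
          = l * eval ![α', β', 1] (pderiv 1 (weierstrassCubic a₁ a₂ a₃ a₄ a₆))) ↔
      ((∃ c : K, c ≠ 0 ∧
          A₁ = c * eval ![α', β', 1] (pderiv 0 (weierstrassCubic a₁ a₂ a₃ a₄ a₆)) ∧
          B₁ = c * eval ![α', β', 1] (pderiv 1 (weierstrassCubic a₁ a₂ a₃ a₄ a₆)) ∧
          C₁ = c * eval ![α', β', 1] (pderiv 2 (weierstrassCubic a₁ a₂ a₃ a₄ a₆))) ∨
        eval ![α', β', 1] ℓ₂ = 0 ∨ eval ![α', β', 1] ℓ₃ = 0) := by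
  have euler := weierstrassCubic_euler a₁ a₂ a₃ a₄ a₆ α' β'
  rw [hE, mul_zero] at euler
  have hX : eval ![α', β', 1] (pderiv 0 ℓ₁) = A₁ := by
    simp [hℓ₁, pderiv_X]
  have hY : eval ![α', β', 1] (pderiv 1 ℓ₁) = B₁ := by
    simp [hℓ₁, pderiv_X]
  have hline : A₁ * α' + B₁ * β' + C₁ = 0 := by simpa [hℓ₁] using hP
  rw [hF, eval_pderiv_mul_mul_of_eval_eq_zero _ _ _ _ hP,
    eval_pderiv_mul_mul_of_eval_eq_zero _ _ _ _ hP, hX, hY]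
  generalize eval ![α', β', 1] (pderiv 0 (weierstrassCubic a₁ a₂ a₃ a₄ a₆)) = u at *
  generalize eval ![α', β', 1] (pderiv 1 (weierstrassCubic a₁ a₂ a₃ a₄ a₆)) = v at *
  generalize eval ![α', β', 1] (pderiv 2 (weierstrassCubic a₁ a₂ a₃ a₄ a₆)) = w at *
  generalize eval ![α', β', 1] ℓ₂ = s
  generalize eval ![α', β', 1] ℓ₃ = t
  constructor
  · rintro ⟨l, hu, hv⟩
    by_cases hs : s = 0
    · exact Or.inr (Or.inl hs)
    by_cases ht : t = 0
    · exact Or.inr (Or.inr ht)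
    have hA : A₁ = l / (s * t) * u := by field_simp; linear_combination hu
    have hB : B₁ = l / (s * t) * v := by field_simp; linear_combination hv
    have hC : C₁ = l / (s * t) * w := by
      linear_combination hline - α' * hA - β' * hB - l / (s * t) * euler
    refine Or.inl ⟨l / (s * t), fun hc => hl₁ ?_, hA, hB, hC⟩
    rw [hA, hB, hC, hc, zero_mul, zero_mul, zero_mul]
  · rintro (⟨c, -, hA, hB, -⟩ | hs | ht)
    · exact ⟨c * (s * t), by rw [hA]; ring, by rw [hB]; ring⟩
    · exact ⟨0, by simp [hs], by simp [hs]⟩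
    · exact ⟨0, by simp [ht], by simp [ht]⟩
end

section
/- For any field K and any a₁, a₂, a₃, a₄, a₆ ∈ K, the homogeneous cubic E = X³ + a₂X²Z + a₄XZ² + a₆Z³ − Y²Z − a₁XYZ − a₃YZ² in K[X,Y,Z] cannot be written as c·ℓ₁ℓ₂ℓ₃ for any scalar c ∈ K and homogeneous linear polynomials ℓ₁, ℓ₂, ℓ₃ ∈ K[X,Y,Z]. -/
open MvPolynomial

/-- A linear polynomial over a field that is a unit has zero leading coefficient. -/
theorem Polynomial.eq_zero_of_isUnit_C_add_C_mul_X {K : Type*} [Field K] {a b : K}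
    (h : IsUnit (Polynomial.C a + Polynomial.C b * Polynomial.X)) : b = 0 := by
  simpa using congr_arg (Polynomial.coeff · 1)
    (Polynomial.eq_C_of_natDegree_eq_zero (Polynomial.natDegree_eq_zero_of_isUnit h))

theorem weierstrassCubic_ne_product_of_lines {K : Type*} [Field K] (a₁ a₂ a₃ a₄ a₆ : K)
    (c A₁ B₁ C₁ A₂ B₂ C₂ A₃ B₃ C₃ : K) :
    weierstrassCubic a₁ a₂ a₃ a₄ a₆ ≠
      C c * (C A₁ * X 0 + C B₁ * X 1 + C C₁ * X 2)
          * (C A₂ * X 0 + C B₂ * X 1 + C C₂ * X 2)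
          * (C A₃ * X 0 + C B₃ * X 1 + C C₃ * X 2) := by
  intro h
  -- On the line at infinity `(1 : t : 0)` the cubic is the constant `1`, so each factor is a unit.
  have h_infinity := congr_arg (aeval ![(1 : Polynomial K), Polynomial.X, 0]) h
  simp only [weierstrassCubic, map_add, map_sub, map_mul, map_pow, aeval_X, algHom_C,
    Polynomial.algebraMap_eq, Matrix.cons_val, one_pow, mul_one, mul_zero, add_zero,
    sub_zero, ne_eq, OfNat.ofNat_ne_zero, not_false_eq_true, zero_pow] at h_infinity
  have h_unit := isUnit_one (M := Polynomial K)
  rw [h_infinity, IsUnit.mul_iff, IsUnit.mul_iff, IsUnit.mul_iff] at h_unit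
  obtain ⟨⟨⟨-, h₁⟩, h₂⟩, h₃⟩ := h_unit
  -- Hence no factor involves `Y`, contradicting the term `Y²Z`, seen on the line `(0 : t : 1)`.
  obtain rfl := Polynomial.eq_zero_of_isUnit_C_add_C_mul_X h₁
  obtain rfl := Polynomial.eq_zero_of_isUnit_C_add_C_mul_X h₂
  obtain rfl := Polynomial.eq_zero_of_isUnit_C_add_C_mul_X h₃
  have h_affine := congr_arg (aeval ![(0 : Polynomial K), Polynomial.X, 1]) h
  simp only [weierstrassCubic, map_add, map_sub, map_mul, map_pow, aeval_X, algHom_C,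
    Polynomial.algebraMap_eq, Matrix.cons_val, one_pow, mul_one, mul_zero, zero_mul, add_zero,
    zero_add, sub_zero, map_zero, ne_eq, OfNat.ofNat_ne_zero, not_false_eq_true, zero_pow]
    at h_affine
  simpa [Polynomial.coeff_X, Polynomial.coeff_C] using
    congr_arg (Polynomial.coeff · 2) h_affine
end
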